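/- arXiv:1111.7109 — 3 statements merged into one kernel-verified Lean document; each statement's English description precedes it below -/
import Mathlib

section
/- Let c₁, …, cₙ ∈ P. Then the relation ≤ between orbits of (P, c₁, …, cₙ) is a partial order on the set of such orbits; explicitly, for all orbits X, Y, Z of (P, c₁, …, cₙ): X ≤ X; if X ≤ Y and Y ≤ X then X = Y; and if X ≤ Y and Y ≤ Z then X ≤ Z. -/
variable {P : Type} [PartialOrder P]

/-- `a` and `b` are incomparable elements of the partial order `P`. -/
def Perp (a b : P) : Prop := ¬ a ≤ b ∧ ¬ b ≤ a

/-- `f` is an order-automorphism of `P`. -/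
def IsOrderAuto (f : Equiv.Perm P) : Prop := ∀ a b : P, f a ≤ f b ↔ a ≤ b

/-- `f` is an anti-automorphism of `P`. -/
def IsAntiAuto (f : Equiv.Perm P) : Prop := ∀ a b : P, f a ≤ f b ↔ b ≤ a

/-- Every finite partial order embeds into `P` (universality). -/
def IsUniversal (P : Type) [PartialOrder P] : Prop :=
  ∀ (Q : Type) [PartialOrder Q] [Fintype Q], Nonempty (Q ↪o P)

/-- Every order-isomorphism between two finite subsets of `P` extends to an
order-automorphism of `P` (homogeneity). -/
def IsHomogeneous (P : Type) [PartialOrder P] : Prop :=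
  ∀ (S T : Finset P) (e : (S : Set P) ≃o (T : Set P)),
    ∃ g : P ≃o P, ∀ x : (S : Set P), g ↑x = ↑(e x)

/-- A subgroup of `Sym(P)` is closed iff it contains every permutation that agrees
with one of its members on each finite subset of `P`. -/
def IsClosedSubgroup (G : Subgroup (Equiv.Perm P)) : Prop :=
  ∀ f : Equiv.Perm P,
    (∀ S : Finset P, ∃ g ∈ G, ∀ x ∈ S, (g : Equiv.Perm P) x = f x) → f ∈ G

/-- `h` is an order-automorphism of `P` fixing each of the constants `c i`. -/
def FixingAuto (n : ℕ) (c : Fin n → P) (h : Equiv.Perm P) : Prop :=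
  IsOrderAuto h ∧ ∀ i : Fin n, h (c i) = c i

/-- `X` is an orbit of `(P, c₁, …, cₙ)`, i.e. an orbit of the action on `P` of the
group of automorphisms of `P` fixing each `c i`. -/
def IsOrbit (n : ℕ) (c : Fin n → P) (X : Set P) : Prop :=
  ∃ x : P, X = {y | ∃ h : Equiv.Perm P, FixingAuto n c h ∧ h x = y}

/-- `g` is canonical as a function from `(P, c₁, …, cₙ)` to `P`. -/
def Canonical (n : ℕ) (c : Fin n → P) (g : P → P) : Prop :=
  ∀ (m : ℕ) (a b : Fin m → P),
    (∃ h : Equiv.Perm P, FixingAuto n c h ∧ ∀ j : Fin m, h (a j) = b j) →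
    ∃ h' : Equiv.Perm P, IsOrderAuto h' ∧ ∀ j : Fin m, h' (g (a j)) = g (b j)

/-- `g` is M-generated by the subgroup `G` of `Sym(P)`: on every finite subset of `P`
it agrees with some member of `G`. -/
def MGen (G : Subgroup (Equiv.Perm P)) (g : P → P) : Prop :=
  ∀ S : Finset P, ∃ h ∈ G, ∀ x ∈ S, (h : Equiv.Perm P) x = g x

/-- `g` behaves like `id` on `X`. -/
def BehavesLikeId (g : P → P) (X : Set P) : Prop :=
  ∀ x ∈ X, ∀ x' ∈ X, (x < x' → g x < g x') ∧ (Perp x x' → Perp (g x) (g x'))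

/-- `g` behaves like `↕` on `X`. -/
def BehavesLikeRev (g : P → P) (X : Set P) : Prop :=
  ∀ x ∈ X, ∀ x' ∈ X, (x < x' → g x' < g x) ∧ (Perp x x' → Perp (g x) (g x'))

/-- `g` behaves like `id` between `X` and `Y`. -/
def BehavesLikeIdBetween (g : P → P) (X Y : Set P) : Prop :=
  ∀ x ∈ X, ∀ y ∈ Y,
    (x < y → g x < g y) ∧ (y < x → g y < g x) ∧ (Perp x y → Perp (g x) (g y))

/-- `X ≤ Y` for subsets: some element of `X` lies below some element of `Y`. -/
def SetLE (X Y : Set P) : Prop := ∃ x ∈ X, ∃ y ∈ Y, x ≤ y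

/-- `X < Y` for subsets: every element of `X` lies strictly below every element of `Y`. -/
def SetLT (X Y : Set P) : Prop := ∀ x ∈ X, ∀ y ∈ Y, x < y

/-- The relation `X ÷ Y`. -/
def SetDiv (X Y : Set P) : Prop :=
  (SetLE X Y ∧ ¬ SetLE Y X ∧ ¬ SetLT X Y) ∨ (SetLE Y X ∧ ¬ SetLE X Y ∧ ¬ SetLT Y X)

/-- `f` is a rotation of `P`. -/
def IsRotation (f : Equiv.Perm P) : Prop :=
  ∃ X Y Z : Set P,
    (∀ p : P, p ∈ X ∨ p ∈ Y ∨ p ∈ Z) ∧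
    Disjoint X Y ∧ Disjoint X Z ∧ Disjoint Y Z ∧
    IsLowerSet X ∧ IsUpperSet Z ∧
    (∀ x ∈ X, ∀ z ∈ Z, x < z) ∧
    BehavesLikeId (⇑f) X ∧ BehavesLikeId (⇑f) Y ∧ BehavesLikeId (⇑f) Z ∧
    (∀ x ∈ X, ∀ z ∈ Z, f z < f x) ∧
    (∀ x ∈ X, ∀ y ∈ Y, (f y < f x ↔ Perp x y) ∧ (Perp (f x) (f y) ↔ x < y)) ∧
    (∀ y ∈ Y, ∀ z ∈ Z, (f z < f y ↔ Perp y z) ∧ (Perp (f y) (f z) ↔ y < z))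

/-- The ternary relation `Cyc`. -/
def Cyc (a b c : P) : Prop :=
  (a < b ∧ b < c) ∨ (b < c ∧ c < a) ∨ (c < a ∧ a < b) ∨
  (a < b ∧ Perp c a ∧ Perp c b) ∨ (b < c ∧ Perp a b ∧ Perp a c) ∨
  (c < a ∧ Perp b a ∧ Perp b c)

/-- The ternary relation `Cyc'`, the dual of `Cyc`. -/
def Cyc' (a b c : P) : Prop := Cyc c b a

/-- The ternary relation `Pari`. -/
def Pari (a b c : P) : Prop :=
  (Perp a b ∧ Perp b c ∧ Perp a c) ∨
  (a < b ∧ a < c ∧ Perp b c) ∨ (b < a ∧ b < c ∧ Perp a c) ∨ (c < a ∧ c < b ∧ Perp a b) ∨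
  (b < a ∧ c < a ∧ Perp b c) ∨ (a < b ∧ c < b ∧ Perp a c) ∨ (a < c ∧ b < c ∧ Perp a b)

/-- `f` preserves the ternary relation `R`. -/
def Preserves3 (f : P → P) (R : P → P → P → Prop) : Prop :=
  ∀ a b c : P, R a b c ↔ R (f a) (f b) (f c)

/-- In a homogeneous order, two points that compare in the same way with each constant `c i`
are conjugate under the automorphisms fixing the constants. -/
theorem exists_fixingAuto_of_same_relations (hH : IsHomogeneous P) {n : ℕ} {c : Fin n → P}
    {x y : P} (hl : ∀ i, c i ≤ x ↔ c i ≤ y) (hu : ∀ i, x ≤ c i ↔ y ≤ c i) :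
    ∃ h : Equiv.Perm P, FixingAuto n c h ∧ h x = y := by
  classical
  by_cases hxy : x = y
  · exact ⟨Equiv.refl P, ⟨fun _ _ => Iff.rfl, fun _ => rfl⟩, hxy⟩
  have hcx : ∀ i, c i ≠ x := fun i hi =>
    hxy (le_antisymm (hi ▸ (hl i).1 hi.le) (hi ▸ (hu i).1 hi.ge))
  have hcy : ∀ i, c i ≠ y := fun i hi =>
    hxy (le_antisymm (hi ▸ (hu i).2 hi.ge) (hi ▸ (hl i).2 hi.le))
  have hfix : ∀ i, Equiv.swap x y (c i) = c i := fun i =>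
    Equiv.swap_apply_of_ne_of_ne (hcx i) (hcy i)
  let S : Finset P := insert x (Finset.univ.image c)
  let T : Finset P := insert y (Finset.univ.image c)
  have hS : ∀ z : P, z ∈ (S : Set P) ↔ z = x ∨ ∃ i, c i = z := by simp [S]
  have hT : ∀ z : P, z ∈ (T : Set P) ↔ z = y ∨ ∃ i, c i = z := by simp [T]
  have hmem : ∀ z : P, z ∈ (S : Set P) ↔ Equiv.swap x y z ∈ (T : Set P) := by
    intro z
    rw [hS, hT, Equiv.swap_apply_eq_iff, Equiv.swap_apply_right]
    refine or_congr_right (exists_congr fun i => ?_)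
    rw [eq_comm (a := c i) (b := Equiv.swap x y z), Equiv.swap_apply_eq_iff, hfix, eq_comm]
  let e : (S : Set P) ≃o (T : Set P) :=
    { toEquiv := (Equiv.swap x y).subtypeEquiv hmem
      map_rel_iff' := by
        rintro ⟨a, ha⟩ ⟨b, hb⟩
        change Equiv.swap x y a ≤ Equiv.swap x y b ↔ a ≤ b
        rcases (hS a).1 ha with rfl | ⟨i, rfl⟩ <;> rcases (hS b).1 hb with rfl | ⟨j, rfl⟩
        · simp
        · rw [hfix, Equiv.swap_apply_left, hu]
        · rw [hfix, Equiv.swap_apply_left, hl]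
        · rw [hfix, hfix] }
  obtain ⟨g, hg⟩ := hH S T e
  refine ⟨g.toEquiv, ⟨fun a b => g.le_iff_le, fun i => ?_⟩, ?_⟩
  · exact (hg ⟨c i, (hS _).2 (Or.inr ⟨i, rfl⟩)⟩).trans (hfix i)
  · exact (hg ⟨x, (hS _).2 (Or.inl rfl)⟩).trans (Equiv.swap_apply_left x y)

theorem FixingAuto.refl (n : ℕ) (c : Fin n → P) : FixingAuto n c (Equiv.refl P) :=
  ⟨fun _ _ => Iff.rfl, fun _ => rfl⟩

theorem FixingAuto.symm {n : ℕ} {c : Fin n → P} {h : Equiv.Perm P} (hh : FixingAuto n c h) :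
    FixingAuto n c h.symm :=
  ⟨fun a b => by simpa using (hh.1 (h.symm a) (h.symm b)).symm,
    fun i => h.symm_apply_eq.2 (hh.2 i).symm⟩

theorem FixingAuto.trans {n : ℕ} {c : Fin n → P} {h k : Equiv.Perm P}
    (hh : FixingAuto n c h) (hk : FixingAuto n c k) : FixingAuto n c (h.trans k) :=
  ⟨fun a b => (hk.1 _ _).trans (hh.1 a b), fun i => (congrArg k (hh.2 i)).trans (hk.2 i)⟩

theorem FixingAuto.le_apply_iff {n : ℕ} {c : Fin n → P} {h : Equiv.Perm P}
    (hh : FixingAuto n c h) (i : Fin n) (x : P) : c i ≤ h x ↔ c i ≤ x := by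
  simpa only [hh.2 i] using hh.1 (c i) x

theorem FixingAuto.apply_le_iff {n : ℕ} {c : Fin n → P} {h : Equiv.Perm P}
    (hh : FixingAuto n c h) (i : Fin n) (x : P) : h x ≤ c i ↔ x ≤ c i := by
  simpa only [hh.2 i] using hh.1 x (c i)

/-- An orbit is the orbit of each of its points. -/
theorem IsOrbit.eq_of_mem {n : ℕ} {c : Fin n → P} {X : Set P} (hX : IsOrbit n c X) {x : P}
    (hx : x ∈ X) : X = {y | ∃ h : Equiv.Perm P, FixingAuto n c h ∧ h x = y} := by
  obtain ⟨x₀, rfl⟩ := hX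
  obtain ⟨k, hk, rfl⟩ := hx
  ext y
  constructor
  · rintro ⟨h, hh, rfl⟩
    exact ⟨k.symm.trans h, hk.symm.trans hh, by simp⟩
  · rintro ⟨h, hh, rfl⟩
    exact ⟨k.trans h, hk.trans hh, rfl⟩

theorem IsOrbit.exists_fixingAuto {n : ℕ} {c : Fin n → P} {X : Set P} (hX : IsOrbit n c X)
    {x x' : P} (hx : x ∈ X) (hx' : x' ∈ X) :
    ∃ h : Equiv.Perm P, FixingAuto n c h ∧ h x = x' := by
  rw [hX.eq_of_mem hx] at hx'
  exact hx'

theorem IsOrbit.apply_mem {n : ℕ} {c : Fin n → P} {X : Set P} (hX : IsOrbit n c X)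
    {x : P} (hx : x ∈ X) {h : Equiv.Perm P} (hh : FixingAuto n c h) : h x ∈ X := by
  rw [hX.eq_of_mem hx]
  exact ⟨h, hh, rfl⟩

/-- The relation `≤` is a partial order on the orbits of `(P, c₁, …, cₙ)`. -/
theorem orbit_order_is_partial_order [Countable P] [Infinite P]
    (hU : IsUniversal P) (hH : IsHomogeneous P)
    (n : ℕ) (c : Fin n → P) :
    (∀ X : Set P, IsOrbit n c X → SetLE X X) ∧
    (∀ X Y : Set P, IsOrbit n c X → IsOrbit n c Y →
      SetLE X Y → SetLE Y X → X = Y) ∧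
    (∀ X Y Z : Set P, IsOrbit n c X → IsOrbit n c Y → IsOrbit n c Z →
      SetLE X Y → SetLE Y Z → SetLE X Z) := by
  refine ⟨?_, ?_, ?_⟩
  · rintro X ⟨x, rfl⟩
    have hx := FixingAuto.refl n c
    exact ⟨x, ⟨_, hx, rfl⟩, x, ⟨_, hx, rfl⟩, le_rfl⟩
  · rintro X Y hX hY ⟨x, hx, y, hy, hxy⟩ ⟨y', hy', x', hx', hyx⟩
    obtain ⟨h, hh, rfl⟩ := hX.exists_fixingAuto hx hx'
    obtain ⟨k, hk, rfl⟩ := hY.exists_fixingAuto hy hy'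
    obtain ⟨f, hf, rfl⟩ := exists_fixingAuto_of_same_relations hH (c := c) (x := x) (y := y)
      (fun i => ⟨fun hi => hi.trans hxy, fun hi =>
        (hh.le_apply_iff i x).1 (((hk.le_apply_iff i y).2 hi).trans hyx)⟩)
      (fun i => ⟨fun hi => (hk.apply_le_iff i y).1 (hyx.trans ((hh.apply_le_iff i x).2 hi)),
        fun hi => hxy.trans hi⟩)
    rw [hX.eq_of_mem (hX.apply_mem hx hf), hY.eq_of_mem hy]
  · rintro X Y Z hX hY - ⟨x, hx, y, hy, hxy⟩ ⟨y', hy', z, hz, hyz⟩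
    obtain ⟨h, hh, rfl⟩ := hY.exists_fixingAuto hy hy'
    exact ⟨h x, hX.apply_mem hx hh, z, hz, ((hh.1 x y).2 hxy).trans hyz⟩
end

section
/- Let 𝒢 be a closed subgroup of Sym(P) with Aut(P) ⊆ 𝒢, let c₁, …, cₙ ∈ P, and let g : P → P be canonical from (P, c₁, …, cₙ) to P and M-generated by 𝒢. Then either 𝒢 = Sym(P), or for every infinite orbit X of (P, c₁, …, cₙ), g behaves like id on X or g behaves like ↕ on X. -/
variable {P : Type} [PartialOrder P]

/-- Tuples of the same order type in a homogeneous poset are related by an automorphism. -/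
theorem IsHomogeneous.exists_auto (hH : IsHomogeneous P) {ι : Type*} [Finite ι] (a b : ι → P)
    (hab : ∀ i j, a i ≤ a j ↔ b i ≤ b j) :
    ∃ h : Equiv.Perm P, IsOrderAuto h ∧ ∀ i, h (a i) = b i := by
  classical
  have := Fintype.ofFinite ι
  have hmem (d : ι → P) (i) : d i ∈ ((Finset.univ.image d : Finset P) : Set P) := by simp
  have hex (d : ι → P) (x : ((Finset.univ.image d : Finset P) : Set P)) : ∃ i, d i = x := by
    simpa using x.2
  choose u hu using hex a
  choose v hv using hex b
  have hau (i) : b (u ⟨a i, hmem a i⟩) = b i :=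
    le_antisymm ((hab _ _).1 (hu ⟨a i, hmem a i⟩).le) ((hab _ _).1 (hu ⟨a i, hmem a i⟩).ge)
  have hbv (i) : a (v ⟨b i, hmem b i⟩) = a i :=
    le_antisymm ((hab _ _).2 (hv ⟨b i, hmem b i⟩).le) ((hab _ _).2 (hv ⟨b i, hmem b i⟩).ge)
  obtain ⟨g, hg⟩ := hH (Finset.univ.image a) (Finset.univ.image b)
    { toFun := fun x => ⟨b (u x), hmem b _⟩
      invFun := fun y => ⟨a (v y), hmem a _⟩
      left_inv := fun x => Subtype.ext ((hbv _).trans (hu x))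
      right_inv := fun y => Subtype.ext ((hau _).trans (hv y))
      map_rel_iff' := by
        intro x y
        change b (u x) ≤ b (u y) ↔ (x : P) ≤ y
        rw [← hab, hu, hu] }
  exact ⟨g.toEquiv, fun x y => g.le_iff_le, fun i => (hg ⟨a i, hmem a i⟩).trans (hau i)⟩

/-- Two elements have the same order type over the constants. -/
def SameType {n : ℕ} (c : Fin n → P) (x y : P) : Prop :=
  ∀ i, (c i ≤ x ↔ c i ≤ y) ∧ (x ≤ c i ↔ y ≤ c i)

theorem FixingAuto.sameType {n : ℕ} {c : Fin n → P} {h : Equiv.Perm P} (hh : FixingAuto n c h)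
    (x : P) : SameType c x (h x) := by
  intro i
  have h₁ := hh.1 (c i) x
  have h₂ := hh.1 x (c i)
  rw [hh.2] at h₁ h₂
  exact ⟨h₁.symm, h₂.symm⟩

/-- Pairs of the same order type, with coordinates of one and the same type over the constants,
are related by an automorphism fixing the constants. -/
theorem IsHomogeneous.exists_fixingAuto (hH : IsHomogeneous P) {n : ℕ} {c : Fin n → P}
    {p q p' q' : P} (hp : SameType c p p') (hq : SameType c q q')
    (h₁ : p ≤ q ↔ p' ≤ q') (h₂ : q ≤ p ↔ q' ≤ p') :
    ∃ h : Equiv.Perm P, FixingAuto n c h ∧ h p = p' ∧ h q = q' := by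
  obtain ⟨h, hh, hv⟩ := hH.exists_auto (Sum.elim c ![p, q]) (Sum.elim c ![p', q']) (by
    rintro (i | i) (j | j)
    · rfl
    · fin_cases j
      exacts [(hp i).1, (hq i).1]
    · fin_cases i
      exacts [(hp j).2, (hq j).2]
    · fin_cases i <;> fin_cases j <;> simp [h₁, h₂])
  exact ⟨h, ⟨hh, fun i => hv (.inl i)⟩, hv (.inr 0), hv (.inr 1)⟩

/-- Every type of an element distinct from all constants contains a copy of every finite poset. -/
theorem exists_embedding_sameType (hU : IsUniversal P) (hH : IsHomogeneous P) {n : ℕ}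
    {c : Fin n → P} {x : P} (hx : ∀ i, c i ≠ x) (Q : Type) [PartialOrder Q] [Finite Q]
    [Nonempty Q] : ∃ e : Q ↪o P, ∀ q, SameType c x (e q) := by
  have q₀ : Q := Classical.arbitrary Q
  let C : Set P := insert x (Set.range c)
  have : Finite C := ((Set.finite_range c).insert x).to_subtype
  have : Finite (C ×ₗ Q) := inferInstanceAs (Finite (C × Q))
  have := Fintype.ofFinite (C ×ₗ Q)
  obtain ⟨e⟩ := hU (C ×ₗ Q)
  let cc (i : Fin n) : C := ⟨c i, Or.inr ⟨i, rfl⟩⟩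
  let xx : C := ⟨x, Or.inl rfl⟩
  have hcx (i) : cc i ≠ xx := fun h => hx i (congrArg Subtype.val h)
  obtain ⟨h, hh, hv⟩ := hH.exists_auto (fun i => e (toLex (cc i, q₀))) c (by
    intro i j
    rw [e.le_iff_le, Prod.Lex.toLex_le_toLex]
    change cc i < cc j ∨ cc i = cc j ∧ q₀ ≤ q₀ ↔ cc i ≤ cc j
    simp [le_iff_lt_or_eq])
  refine ⟨OrderEmbedding.ofMapLEIff (fun q => h (e (toLex (xx, q)))) ?_, ?_⟩
  · intro q q'
    rw [hh, e.le_iff_le, Prod.Lex.toLex_le_toLex]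
    simp
  · intro q i
    change (cc i ≤ xx ↔ c i ≤ h _) ∧ (xx ≤ cc i ↔ h _ ≤ c i)
    rw [← hv i, hh, hh, e.le_iff_le, e.le_iff_le, Prod.Lex.toLex_le_toLex,
      Prod.Lex.toLex_le_toLex]
    simp [le_iff_lt_or_eq, hcx, (hcx _).symm]

theorem Canonical.pair {n : ℕ} {c : Fin n → P} {g : P → P} (hcan : Canonical n c g)
    {h : Equiv.Perm P} (hh : FixingAuto n c h) (p q : P) :
    (g p ≤ g q ↔ g (h p) ≤ g (h q)) := by
  obtain ⟨k, hk, hv⟩ := hcan 2 ![p, q] ![h p, h q] ⟨h, hh, by simp [Fin.forall_fin_two]⟩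
  have h₀ : k (g p) = g (h p) := hv 0
  have h₁ : k (g q) = g (h q) := hv 1
  rw [← h₀, ← h₁, hk]

theorem MGen.injective {α : Type} {G : Subgroup (Equiv.Perm α)} {g : α → α} (hM : MGen G g) :
    Function.Injective g := by
  classical
  intro x y hxy
  obtain ⟨h, -, hh⟩ := hM {x, y}
  apply h.injective
  rw [hh x (by simp), hh y (by simp), hxy]

/-- A closed supergroup of the automorphism group is everything as soon as it can turn every finite
set into an antichain. -/
theorem IsClosedSubgroup.eq_top_of_antichain (hH : IsHomogeneous P)
    {G : Subgroup (Equiv.Perm P)} (hG : IsClosedSubgroup G)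
    (hAut : ∀ f : Equiv.Perm P, IsOrderAuto f → f ∈ G)
    (hanti : ∀ S : Finset P, ∃ k ∈ G, ∀ x ∈ S, ∀ y ∈ S, k x ≤ k y → x = y) : G = ⊤ := by
  classical
  refine (Subgroup.eq_top_iff' G).2 fun f => hG f fun S => ?_
  obtain ⟨k, hk, hkS⟩ := hanti S
  obtain ⟨l, hl, hlS⟩ := hanti (S.image f)
  obtain ⟨h, hh, hv⟩ := hH.exists_auto (fun s : S => k s) (fun s : S => l (f s)) (by
    rintro ⟨x, hx⟩ ⟨y, hy⟩
    constructor
    · intro hxy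
      exact (congrArg (fun z => l (f z)) (hkS x hx y hy hxy)).le
    · intro hxy
      have := hlS _ (Finset.mem_image_of_mem f hx) _ (Finset.mem_image_of_mem f hy) hxy
      exact (congrArg k (f.injective this)).le)
  refine ⟨l⁻¹ * h * k, G.mul_mem (G.mul_mem (G.inv_mem hl) (hAut h hh)) hk, fun x hx => ?_⟩
  have : h (k x) = l (f x) := hv ⟨x, hx⟩
  simp [this]

/-- A canonical injection preserves incomparability inside a type over the constants. -/
theorem Canonical.perp (hH : IsHomogeneous P) {n : ℕ} {c : Fin n → P} {g : P → P}
    (hcan : Canonical n c g) (hg : Function.Injective g) {x p q : P} (hp : SameType c x p)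
    (hq : SameType c x q) (hpq : Perp p q) : Perp (g p) (g q) := by
  have hs : SameType c p q :=
    fun i => ⟨(hp i).1.symm.trans (hq i).1, (hp i).2.symm.trans (hq i).2⟩
  have hs' : SameType c q p := fun i => ⟨(hs i).1.symm, (hs i).2.symm⟩
  obtain ⟨h, hh, h₁, h₂⟩ := hH.exists_fixingAuto hs hs' (by simp [hpq.1, hpq.2])
    (by simp [hpq.1, hpq.2])
  have hsymm := hcan.pair hh p q
  rw [h₁, h₂] at hsymm
  have hne : g p ≠ g q := fun h => hpq.1 (hg h).le
  exact ⟨fun h => hne (h.antisymm (hsymm.1 h)), fun h => hne ((hsymm.2 h).antisymm h)⟩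

/-- A canonical function treats any two strictly increasing pairs of one type alike. -/
theorem Canonical.le_iff_of_lt (hH : IsHomogeneous P) {n : ℕ} {c : Fin n → P} {g : P → P}
    (hcan : Canonical n c g) {x p q p' q' : P} (hp : SameType c x p) (hq : SameType c x q)
    (hp' : SameType c x p') (hq' : SameType c x q') (hpq : p < q) (hpq' : p' < q') :
    (g p ≤ g q ↔ g p' ≤ g q') ∧ (g q ≤ g p ↔ g q' ≤ g p') := by
  obtain ⟨h, hh, rfl, rfl⟩ := hH.exists_fixingAuto
    (c := c) (p := p) (q := q) (p' := p') (q' := q')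
    (fun i => ⟨(hp i).1.symm.trans (hp' i).1, (hp i).2.symm.trans (hp' i).2⟩)
    (fun i => ⟨(hq i).1.symm.trans (hq' i).1, (hq i).2.symm.trans (hq' i).2⟩)
    (by simp [hpq.le, hpq'.le]) (by simp [hpq.not_ge, hpq'.not_ge])
  exact ⟨hcan.pair hh p q, hcan.pair hh q p⟩

/-- If a canonical function makes some comparable pair inside a nontrivial type incomparable,
then every finite set can be turned into an antichain. -/
theorem exists_antichain_of_perp (hU : IsUniversal P) (hH : IsHomogeneous P)
    {G : Subgroup (Equiv.Perm P)} (hAut : ∀ f : Equiv.Perm P, IsOrderAuto f → f ∈ G)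
    {n : ℕ} {c : Fin n → P} {g : P → P} (hcan : Canonical n c g) (hM : MGen G g)
    {x p q : P} (hx : ∀ i, c i ≠ x) (hp : SameType c x p) (hq : SameType c x q) (hpq : p < q)
    (hperp : Perp (g p) (g q)) (S : Finset P) :
    ∃ k ∈ G, ∀ x ∈ S, ∀ y ∈ S, k x ≤ k y → x = y := by
  classical
  rcases S.eq_empty_or_nonempty with rfl | ⟨s, hs⟩
  · exact ⟨1, G.one_mem, by simp⟩
  have : Nonempty S := ⟨⟨s, hs⟩⟩
  obtain ⟨e, he⟩ := exists_embedding_sameType hU hH hx S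
  obtain ⟨h, hh, hv⟩ := hH.exists_auto (fun s : S => (s : P)) e (fun i j => e.le_iff_le.symm)
  obtain ⟨k, hk, hkg⟩ := hM (S.image h)
  refine ⟨k * h, G.mul_mem hk (hAut h hh), fun y hy z hz hyz => ?_⟩
  rw [Equiv.Perm.mul_apply, Equiv.Perm.mul_apply, hkg _ (Finset.mem_image_of_mem h hy),
    hkg _ (Finset.mem_image_of_mem h hz)] at hyz
  have hy' : SameType c x (h y) := hv ⟨y, hy⟩ ▸ he ⟨y, hy⟩
  have hz' : SameType c x (h z) := hv ⟨z, hz⟩ ▸ he ⟨z, hz⟩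
  by_contra hne
  have hne' : h y ≠ h z := fun h' => hne (h.injective h')
  by_cases h₁ : h y ≤ h z
  · exact hperp.1 ((hcan.le_iff_of_lt hH hp hq hy' hz' hpq (h₁.lt_of_ne hne')).1.2 hyz)
  by_cases h₂ : h z ≤ h y
  · exact hperp.2 ((hcan.le_iff_of_lt hH hp hq hz' hy' hpq (h₂.lt_of_ne hne'.symm)).2.2 hyz)
  exact (hcan.perp hH hM.injective hy' hz' ⟨h₁, h₂⟩ |>.1) hyz

/-- A canonical function M-generated by `𝒢` behaves like `id` or like `↕` on each
infinite orbit, unless `𝒢 = Sym(P)`. -/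
theorem canonical_id_or_rev_on_orbits [Countable P] [Infinite P]
    (hU : IsUniversal P) (hH : IsHomogeneous P)
    (G : Subgroup (Equiv.Perm P)) (hG : IsClosedSubgroup G)
    (hAut : ∀ f : Equiv.Perm P, IsOrderAuto f → f ∈ G)
    (n : ℕ) (c : Fin n → P) (g : P → P)
    (hcan : Canonical n c g) (hM : MGen G g) :
    G = ⊤ ∨
      ∀ X : Set P, IsOrbit n c X → X.Infinite →
        BehavesLikeId g X ∨ BehavesLikeRev g X := by
  by_cases htop : G = ⊤
  · exact Or.inl htop
  refine Or.inr ?_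
  rintro X ⟨x, rfl⟩ hinf
  have hx (i) : c i ≠ x := by
    rintro rfl
    refine hinf ((Set.finite_singleton (c i)).subset ?_)
    rintro y ⟨h, hh, rfl⟩
    exact hh.2 i
  have htype : ∀ y ∈ {y | ∃ h : Equiv.Perm P, FixingAuto n c h ∧ h x = y}, SameType c x y := by
    rintro y ⟨h, hh, rfl⟩
    exact hh.sameType x
  generalize {y | ∃ h : Equiv.Perm P, FixingAuto n c h ∧ h x = y} = X at htype
  have hperp {p q} (hp : p ∈ X) (hq : q ∈ X) : Perp p q → Perp (g p) (g q) :=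
    hcan.perp hH hM.injective (htype p hp) (htype q hq)
  by_cases hlt : ∃ p ∈ X, ∃ q ∈ X, p < q
  · obtain ⟨p, hp, q, hq, hpq⟩ := hlt
    have hsame {p' q'} (hp' : p' ∈ X) (hq' : q' ∈ X) (hpq' : p' < q') :=
      hcan.le_iff_of_lt hH (htype p hp) (htype q hq) (htype p' hp') (htype q' hq') hpq hpq'
    by_cases h₁ : g p ≤ g q
    · exact Or.inl fun y hy z hz => ⟨fun hyz =>
        ((hsame hy hz hyz).1.1 h₁).lt_of_ne (hM.injective.ne hyz.ne), hperp hy hz⟩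
    by_cases h₂ : g q ≤ g p
    · exact Or.inr fun y hy z hz => ⟨fun hyz =>
        ((hsame hy hz hyz).2.1 h₂).lt_of_ne (hM.injective.ne hyz.ne'), hperp hy hz⟩
    exact absurd (hG.eq_top_of_antichain hH hAut (exists_antichain_of_perp hU hH hAut hcan hM hx
      (htype p hp) (htype q hq) hpq ⟨h₁, h₂⟩)) htop
  · exact Or.inl fun y hy z hz => ⟨fun hyz => absurd ⟨y, hy, z, hz, hyz⟩ hlt, hperp hy hz⟩
end

section
/- Let 𝒢 be a closed subgroup of Sym(P) with Aut(P) ⊆ 𝒢, let c₁, …, cₙ ∈ P, and let g : P → P be canonical from (P, c₁, …, cₙ) to P and M-generated by 𝒢. If g behaves like ↕ on some infinite orbit of (P, c₁, …, cₙ), then 𝒢 contains every anti-automorphism of P. -/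
variable {P : Type} [PartialOrder P]

/-- In a homogeneous partial order, two finite families of the same order type are
conjugate under an automorphism. -/
theorem IsHomogeneous.exists_isOrderAuto (hH : IsHomogeneous P) {A : Type} [Finite A]
    (u v : A → P) (huv : ∀ a b, u a ≤ u b ↔ v a ≤ v b) :
    ∃ h : Equiv.Perm P, IsOrderAuto h ∧ ∀ a, h (u a) = v a := by
  classical
  have : Fintype A := Fintype.ofFinite A
  have hfac : Function.FactorsThrough v u := fun a b hab =>
    le_antisymm ((huv a b).1 hab.le) ((huv b a).1 hab.ge)
  let S : Finset P := Finset.univ.image u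
  let T : Finset P := Finset.univ.image v
  have hS (x : (S : Set P)) : ∃ a, u a = x := by
    have hx := x.2
    simpa [S] using hx
  have hT (y : (T : Set P)) : ∃ a, v a = y := by
    have hy := y.2
    simpa [T] using hy
  let k : ↥(S : Set P) → ↥(T : Set P) := fun x => ⟨v (hS x).choose, by simp [T]⟩
  have hk (x : (S : Set P)) (a : A) (ha : u a = x) : (k x : P) = v a :=
    hfac ((hS x).choose_spec.trans ha.symm)
  have hle (x y : (S : Set P)) : k x ≤ k y ↔ x ≤ y := by
    obtain ⟨a, ha⟩ := hS x
    obtain ⟨b, hb⟩ := hS y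
    rw [← Subtype.coe_le_coe, ← Subtype.coe_le_coe, hk x a ha, hk y b hb, ← ha, ← hb, huv]
  have hsurj : Function.Surjective k := fun y => by
    obtain ⟨a, ha⟩ := hT y
    exact ⟨⟨u a, by simp [S]⟩, Subtype.ext ((hk _ a rfl).trans ha)⟩
  obtain ⟨h, hh⟩ := hH S T
    (RelIso.ofSurjective (OrderEmbedding.ofMapLEIff k hle) hsurj)
  refine ⟨h.toEquiv, fun a b => h.le_iff_le, fun a => ?_⟩
  exact (hh ⟨u a, by simp [S]⟩).trans (hk _ a rfl)

/-- An element whose orbit over `c` is infinite is not one of the constants. -/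
theorem ne_constant_of_infinite_orbit {n : ℕ} {c : Fin n → P} {x : P}
    (hX : {y | ∃ h : Equiv.Perm P, FixingAuto n c h ∧ h x = y}.Infinite) (i : Fin n) :
    c i ≠ x := by
  rintro rfl
  refine hX ((Set.finite_singleton (c i)).subset ?_)
  rintro y ⟨h, hh, rfl⟩
  exact hh.2 i

/-- Every finite partial order embeds into every infinite orbit of `(P, c₁, …, cₙ)`. -/
theorem exists_orderEmbedding_orbit (hU : IsUniversal P) (hH : IsHomogeneous P)
    {n : ℕ} {c : Fin n → P} {X : Set P} (hX : IsOrbit n c X) (hinf : X.Infinite)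
    (Q : Type) [PartialOrder Q] [Finite Q] :
    ∃ y : Q ↪o P, ∀ q, y q ∈ X := by
  classical
  obtain ⟨x, rfl⟩ := hX
  have hx := ne_constant_of_infinite_orbit hinf
  have : Fintype Q := Fintype.ofFinite Q
  rcases isEmpty_or_nonempty Q with hQ | ⟨⟨q₀⟩⟩
  · exact ⟨OrderEmbedding.ofIsEmpty, fun q => isEmptyElim q⟩
  let T : Type := (insert x (Set.range c) : Set P)
  have : Finite T := ((Set.finite_range c).insert x).to_subtype
  have : Fintype (T ×ₗ Q) := Fintype.ofFinite (T × Q)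
  obtain ⟨φ⟩ := hU (T ×ₗ Q)
  have hφ (σ : T → Q) (s t : T) :
      φ (toLex (s, σ s)) ≤ φ (toLex (t, σ t)) ↔ (s : P) ≤ t := by
    rw [φ.le_iff_le, Prod.Lex.toLex_le_toLex, Subtype.coe_le_coe, le_iff_lt_or_eq (a := s)]
    refine or_congr_right ⟨And.left, fun h => ⟨h, ?_⟩⟩
    dsimp only at h ⊢
    rw [h]
  obtain ⟨γ, hγ, hγφ⟩ := hH.exists_isOrderAuto (fun t : T => φ (toLex (t, q₀)))
    (fun t : T => (t : P)) (hφ fun _ => q₀)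
  let x' : T := ⟨x, Set.mem_insert _ _⟩
  refine ⟨OrderEmbedding.ofMapLEIff (fun q => γ (φ (toLex (x', q)))) fun p q => ?_,
    fun q => ?_⟩
  · rw [hγ, φ.le_iff_le, Prod.Lex.toLex_le_toLex]
    simp
  · let σ : T → Q := fun t => if t = x' then q else q₀
    obtain ⟨h, hh, hhσ⟩ := hH.exists_isOrderAuto (fun t : T => (t : P))
      (fun t : T => γ (φ (toLex (t, σ t)))) fun s t => by rw [hγ, hφ σ]
    refine ⟨h, ⟨hh, fun i => ?_⟩, ?_⟩
    · let t : T := ⟨c i, Set.mem_insert_of_mem _ ⟨i, rfl⟩⟩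
      have ht : σ t = q₀ := if_neg fun e => hx i (congrArg Subtype.val e)
      have := hhσ t
      rw [ht, hγφ t] at this
      exact this
    · have := hhσ x'
      rw [show σ x' = q from if_pos rfl] at this
      exact this

/-- A function behaving like `↕` on `X` reverses the order on `X`. -/
theorem BehavesLikeRev.le_iff_le {g : P → P} {X : Set P} (hg : BehavesLikeRev g X)
    {x y : P} (hx : x ∈ X) (hy : y ∈ X) : g x ≤ g y ↔ y ≤ x := by
  constructor
  · intro h
    by_contra hyx
    by_cases hxy : x ≤ y
    · exact ((hg x hx y hy).1 (lt_of_le_not_ge hxy hyx)).not_ge h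
    · exact ((hg x hx y hy).2 ⟨hxy, hyx⟩).1 h
  · intro h
    rcases h.eq_or_lt with rfl | h
    · exact le_rfl
    · exact ((hg y hy x hx).1 h).le

/-- If a canonical function M-generated by `𝒢` behaves like `↕` on some infinite
orbit, then `𝒢` contains every anti-automorphism of `P`. -/
theorem canonical_rev_generates_antiautos [Countable P] [Infinite P]
    (hU : IsUniversal P) (hH : IsHomogeneous P)
    (G : Subgroup (Equiv.Perm P)) (hG : IsClosedSubgroup G)
    (hAut : ∀ f : Equiv.Perm P, IsOrderAuto f → f ∈ G)
    (n : ℕ) (c : Fin n → P) (g : P → P)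
    (hcan : Canonical n c g) (hM : MGen G g)
    (hrev : ∃ X : Set P, IsOrbit n c X ∧ X.Infinite ∧ BehavesLikeRev g X) :
    ∀ f : Equiv.Perm P, IsAntiAuto f → f ∈ G := by
  obtain ⟨X, hX, hinf, hg⟩ := hrev
  intro f hf
  refine hG f fun S => ?_
  classical
  obtain ⟨y, hy⟩ := exists_orderEmbedding_orbit hU hH hX hinf S
  obtain ⟨α, hα, hαy⟩ := hH.exists_isOrderAuto (fun s : S => (s : P)) y
    fun s t => y.le_iff_le.symm
  obtain ⟨β, hβ, hβf⟩ := hH.exists_isOrderAuto (fun s : S => g (y s)) (fun s : S => f s)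
    fun s t => by rw [hg.le_iff_le (hy s) (hy t), y.le_iff_le, hf, Subtype.coe_le_coe]
  obtain ⟨h, hh, hhg⟩ := hM (Finset.univ.image y)
  refine ⟨β * h * α, G.mul_mem (G.mul_mem (hAut β hβ) hh) (hAut α hα), fun s hs => ?_⟩
  have h₁ : α s = y ⟨s, hs⟩ := hαy ⟨s, hs⟩
  rw [Equiv.Perm.mul_apply, Equiv.Perm.mul_apply, h₁,
    hhg _ (Finset.mem_image_of_mem _ (Finset.mem_univ _))]
  exact hβf ⟨s, hs⟩
end
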